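/- (Sharp Rényi–Shannon inequality, case 0 < α < 1, Euclidean) Let α ∈ (0,1) and b > n(1/α - 1). For any nonnegative u ∈ L¹(ℝⁿ) with ∫ u = 1 and ∫ |x|^b u(x) dx < ∞, one has (1-α)⁻¹ log ∫ u^α ≤ (n/b) log ( A^{b/n} ∫ |x|^b u dx ), where A = C₁⁻¹ (αb/(αb - n(1-α)))^{1/(1-α)} ((αb - n(1-α))/(n(1-α)))^{n/b} and C₁ = (b/|𝕊ⁿ⁻¹|) Γ(1/(1-α)) / (Γ(1/(1-α) - n/b) Γ(n/b)). -/

import Mathlib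

open MeasureTheory Real

theorem lintegral_rpow_mul_exp_neg_mul_Ioi {s c : ℝ} (hs : 0 < s) (hc : 0 < c) :
    ∫⁻ t in Set.Ioi (0 : ℝ), ENNReal.ofReal (t ^ (s - 1) * exp (-c * t)) =
      ENNReal.ofReal (c ^ (-s) * Gamma s) := by
  have hint := integrableOn_rpow_mul_exp_neg_mul_rpow (show -1 < s - 1 by linarith) one_pos hc
  have hval := integral_rpow_mul_exp_neg_mul_rpow one_pos (show -1 < s - 1 by linarith) hc
  simp only [rpow_one, sub_add_cancel, div_one, mul_one] at hint hval
  rw [← hval, ofReal_integral_eq_lintegral_ofReal hint]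
  filter_upwards [ae_restrict_mem measurableSet_Ioi] with t ht
  exact mul_nonneg (rpow_nonneg (le_of_lt ht) _) (exp_pos _).le

theorem finrank_mul_volume_real_ball_one (n : ℕ) (hn : 1 ≤ n) :
    (n : ℝ) * (volume : Measure (EuclideanSpace ℝ (Fin n))).real (Metric.ball 0 1) =
      2 * π ^ ((n : ℝ) / 2) / Gamma ((n : ℝ) / 2) := by
  have : Nonempty (Fin n) := ⟨⟨0, hn⟩⟩
  have hn0 : (0 : ℝ) < n := by exact_mod_cast hn
  have hG := Gamma_pos_of_pos (half_pos hn0)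
  have hsqrt : √π ^ n = π ^ ((n : ℝ) / 2) := by
    rw [sqrt_eq_rpow, ← rpow_natCast, ← rpow_mul pi_pos.le]
    ring_nf
  rw [Measure.real, EuclideanSpace.volume_ball, Fintype.card_fin, ENNReal.ofReal_one, one_pow,
    one_mul, Gamma_add_one (half_pos hn0).ne', ENNReal.toReal_ofReal (by positivity), hsqrt]
  field_simp

theorem lintegral_exp_neg_mul_norm_rpow (n : ℕ) (hn : 1 ≤ n) {b t : ℝ} (hb : 0 < b) (ht : 0 < t) :
    ∫⁻ x : EuclideanSpace ℝ (Fin n), ENNReal.ofReal (exp (-t * ‖x‖ ^ b)) =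
      ENNReal.ofReal (2 * π ^ ((n : ℝ) / 2) / Gamma ((n : ℝ) / 2) / b * Gamma ((n : ℝ) / b) *
        t ^ (-((n : ℝ) / b))) := by
  have : Nonempty (Fin n) := ⟨⟨0, hn⟩⟩
  have hn0 : (1 : ℝ) ≤ n := by exact_mod_cast hn
  have hpow (y : ℝ) : y ^ (n - 1) = y ^ ((n : ℝ) - 1) := by
    rw [← rpow_natCast, Nat.cast_sub hn, Nat.cast_one]
  have hint : Integrable (fun x : EuclideanSpace ℝ (Fin n) => exp (-t * ‖x‖ ^ b)) := by
    rw [integrable_fun_norm_addHaar volume (f := fun r : ℝ => exp (-t * r ^ b))]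
    simp only [finrank_euclideanSpace, Fintype.card_fin, smul_eq_mul, hpow]
    exact integrableOn_rpow_mul_exp_neg_mul_rpow (by linarith) hb ht
  rw [← ofReal_integral_eq_lintegral_ofReal hint (.of_forall fun _ => (exp_pos _).le),
    integral_fun_norm_addHaar volume (fun r : ℝ => exp (-t * r ^ b))]
  simp only [finrank_euclideanSpace, Fintype.card_fin, smul_eq_mul, hpow, nsmul_eq_mul]
  rw [integral_rpow_mul_exp_neg_mul_rpow hb (by linarith) ht, ← mul_assoc,
    finrank_mul_volume_real_ball_one n hn, sub_add_cancel, neg_div]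
  ring_nf

theorem lintegral_one_add_mul_norm_rpow_rpow_neg (n : ℕ) (hn : 1 ≤ n) {b q c : ℝ} (hb : 0 < b)
    (hc : 0 < c) (hq : (n : ℝ) / b < q) :
    ∫⁻ x : EuclideanSpace ℝ (Fin n), ENNReal.ofReal ((1 + c * ‖x‖ ^ b) ^ (-q)) =
      ENNReal.ofReal (2 * π ^ ((n : ℝ) / 2) / Gamma ((n : ℝ) / 2) / b *
        (Gamma ((n : ℝ) / b) * Gamma (q - (n : ℝ) / b) / Gamma q) * c ^ (-((n : ℝ) / b))) := by
  have hn0 : (0 : ℝ) < n := by exact_mod_cast hn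
  have hq0 : 0 < q := lt_trans (by positivity) hq
  have hGq := Gamma_pos_of_pos hq0
  have hGn := Gamma_pos_of_pos (half_pos hn0)
  have hGb := Gamma_pos_of_pos (div_pos hn0 hb)
  have hmeas : Measurable fun z : EuclideanSpace ℝ (Fin n) × ℝ =>
      ENNReal.ofReal ((Gamma q)⁻¹ * (z.2 ^ (q - 1) * exp (-(1 + c * ‖z.1‖ ^ b) * z.2))) := by
    fun_prop
  set K := 2 * π ^ ((n : ℝ) / 2) / Gamma ((n : ℝ) / 2) / b * Gamma ((n : ℝ) / b) with hK
  have hK0 : 0 < K := by positivity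
  calc
    _ = ∫⁻ x : EuclideanSpace ℝ (Fin n), ∫⁻ t in Set.Ioi (0 : ℝ),
        ENNReal.ofReal ((Gamma q)⁻¹ * (t ^ (q - 1) * exp (-(1 + c * ‖x‖ ^ b) * t))) := by
      refine lintegral_congr fun x => ?_
      simp_rw [ENNReal.ofReal_mul (inv_nonneg.2 hGq.le)]
      rw [lintegral_const_mul' _ _ ENNReal.ofReal_ne_top,
        lintegral_rpow_mul_exp_neg_mul_Ioi hq0 (by positivity),
        ← ENNReal.ofReal_mul (inv_nonneg.2 hGq.le)]
      congr 1
      field_simp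
    _ = ∫⁻ t in Set.Ioi (0 : ℝ), ∫⁻ x : EuclideanSpace ℝ (Fin n),
        ENNReal.ofReal ((Gamma q)⁻¹ * (t ^ (q - 1) * exp (-(1 + c * ‖x‖ ^ b) * t))) :=
      lintegral_lintegral_swap hmeas.aemeasurable
    _ = ∫⁻ t in Set.Ioi (0 : ℝ), ENNReal.ofReal ((Gamma q)⁻¹ * K * c ^ (-((n : ℝ) / b))) *
        ENNReal.ofReal (t ^ (q - (n : ℝ) / b - 1) * exp (-1 * t)) := by
      refine setLIntegral_congr_fun measurableSet_Ioi fun t (ht : 0 < t) => ?_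
      have hsplit (x : EuclideanSpace ℝ (Fin n)) :
          (Gamma q)⁻¹ * (t ^ (q - 1) * exp (-(1 + c * ‖x‖ ^ b) * t)) =
            (Gamma q)⁻¹ * t ^ (q - 1) * exp (-1 * t) * exp (-(c * t) * ‖x‖ ^ b) := by
        rw [mul_assoc _ (exp _), ← exp_add]
        ring_nf
      have hpre : 0 ≤ (Gamma q)⁻¹ * t ^ (q - 1) * exp (-1 * t) := by positivity
      simp_rw [hsplit, ENNReal.ofReal_mul hpre]
      rw [lintegral_const_mul' _ _ ENNReal.ofReal_ne_top,
        lintegral_exp_neg_mul_norm_rpow n hn hb (mul_pos hc ht), ← hK, ← ENNReal.ofReal_mul hpre,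
        ← ENNReal.ofReal_mul (by positivity), mul_rpow hc.le ht.le,
        show q - (n : ℝ) / b - 1 = (q - 1) + -((n : ℝ) / b) by ring, rpow_add ht]
      ring_nf
    _ = _ := by
      rw [lintegral_const_mul' _ _ ENNReal.ofReal_ne_top,
        lintegral_rpow_mul_exp_neg_mul_Ioi (sub_pos.2 hq) one_pos, one_rpow, one_mul,
        ← ENNReal.ofReal_mul (by positivity), hK]
      congr 1
      field_simp

theorem integral_rpow_pos_and_le_of_lintegral_le {X : Type*} [MeasurableSpace X] {μ : Measure X}
    {α M I : ℝ} (hα : α ∈ Set.Ioo (0 : ℝ) 1) {u w : X → ℝ}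
    (hu_meas : Measurable u) (hu_nonneg : ∀ x, 0 ≤ u x) (hu_ne : ¬ u =ᵐ[μ] 0)
    (hw_meas : Measurable w) (hw_pos : ∀ x, 0 < w x) (hI : 0 ≤ I)
    (huw : Integrable (fun x => w x * u x) μ) (hM : ∫ x, w x * u x ∂μ = M)
    (hw_int : ∫⁻ x, ENNReal.ofReal (w x ^ (-(α / (1 - α)))) ∂μ = ENNReal.ofReal I) :
    0 < ∫ x, u x ^ α ∂μ ∧ ∫ x, u x ^ α ∂μ ≤ M ^ α * I ^ (1 - α) := by
  obtain ⟨hα0, hα1⟩ := hα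
  have h1α : 0 < 1 - α := sub_pos.2 hα1
  have huw_nonneg (x : X) : 0 ≤ w x * u x := mul_nonneg (hw_pos x).le (hu_nonneg x)
  have hM0 : 0 ≤ M := hM ▸ integral_nonneg huw_nonneg
  have hpt (x : X) : ENNReal.ofReal (u x ^ α) = ENNReal.ofReal (w x * u x) ^ α *
      ENNReal.ofReal (w x ^ (-(α / (1 - α)))) ^ (1 - α) := by
    have hw := hw_pos x
    rw [ENNReal.ofReal_rpow_of_nonneg (huw_nonneg x) hα0.le,
      ENNReal.ofReal_rpow_of_nonneg (by positivity) h1α.le,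
      ← ENNReal.ofReal_mul (rpow_nonneg (huw_nonneg x) _), ← rpow_mul hw.le, neg_mul,
      div_mul_cancel₀ _ h1α.ne', mul_rpow hw.le (hu_nonneg x), rpow_neg hw.le]
    congr 1
    field_simp
  have hle : ∫⁻ x, ENNReal.ofReal (u x ^ α) ∂μ ≤ ENNReal.ofReal (M ^ α * I ^ (1 - α)) := by
    simp_rw [hpt]
    refine (ENNReal.lintegral_mul_norm_pow_le (by fun_prop) (by fun_prop) hα0.le h1α.le
      (by ring)).trans_eq ?_
    rw [hw_int, ← ofReal_integral_eq_lintegral_ofReal huw (.of_forall huw_nonneg), hM,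
      ENNReal.ofReal_rpow_of_nonneg hM0 hα0.le, ENNReal.ofReal_rpow_of_nonneg hI h1α.le,
      ← ENNReal.ofReal_mul (by positivity)]
  have hmeas : Measurable fun x => u x ^ α := by fun_prop
  have hnonneg (x : X) : 0 ≤ u x ^ α := rpow_nonneg (hu_nonneg x) _
  rw [integral_eq_lintegral_of_nonneg_ae (.of_forall hnonneg) hmeas.aestronglyMeasurable]
  refine ⟨ENNReal.toReal_pos (fun h => hu_ne ?_) (ne_top_of_le_ne_top ENNReal.ofReal_ne_top hle),
    ENNReal.toReal_le_of_le_ofReal (by positivity) hle⟩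
  filter_upwards [(lintegral_eq_zero_iff (by fun_prop)).1 h] with x hx
  have hx0 : u x ^ α ≤ 0 := by simpa using hx
  exact (rpow_eq_zero (hu_nonneg x) hα0.ne').1 (le_antisymm hx0 (hnonneg x))

/-- Sharp Rényi–Shannon inequality in `ℝⁿ` for `0 < α < 1`. -/
theorem renyi_shannon_inequality_lt_one (n : ℕ) (hn : 1 ≤ n) (α b : ℝ)
    (hα : α ∈ Set.Ioo (0 : ℝ) 1) (hb : (n : ℝ) * (1 / α - 1) < b)
    (u : EuclideanSpace ℝ (Fin n) → ℝ)
    (hu_meas : Measurable u) (hu_nonneg : ∀ x, 0 ≤ u x)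
    (hu_int : Integrable u) (hu_mass : ∫ x, u x = 1)
    (hu_mom : Integrable (fun x => ‖x‖ ^ b * u x))
    (C₁ A : ℝ)
    (hC₁ : C₁ = b / (2 * Real.pi ^ ((n : ℝ) / 2) / Real.Gamma ((n : ℝ) / 2)) *
      (Real.Gamma (1 / (1 - α)) /
        (Real.Gamma (1 / (1 - α) - (n : ℝ) / b) * Real.Gamma ((n : ℝ) / b))))
    (hA : A = C₁⁻¹ * (α * b / (α * b - (n : ℝ) * (1 - α))) ^ (1 / (1 - α)) *
      ((α * b - (n : ℝ) * (1 - α)) / ((n : ℝ) * (1 - α))) ^ ((n : ℝ) / b)) :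
    (1 - α)⁻¹ * Real.log (∫ x, u x ^ α) ≤
      ((n : ℝ) / b) * Real.log (A ^ (b / (n : ℝ)) * ∫ x, ‖x‖ ^ b * u x) := by
  obtain ⟨hα0, hα1⟩ := hα
  have hn0 : (0 : ℝ) < n := by exact_mod_cast hn
  have h1α : 0 < 1 - α := sub_pos.2 hα1
  have hnb : (n : ℝ) * (1 - α) < α * b := by
    have h := mul_lt_mul_of_pos_left hb hα0
    have h' : α * ((n : ℝ) * (1 / α - 1)) = n * (1 - α) := by field_simp
    linarith
  have hb0 : 0 < b := pos_of_mul_pos_right ((by positivity : (0 : ℝ) < n * (1 - α)).trans hnb) hα0.le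
  have hD : 0 < α * b - n * (1 - α) := sub_pos.2 hnb
  set q := α / (1 - α) with hq
  have hq0 : 0 < q := by positivity
  have hqn : (n : ℝ) / b < q := by
    rw [hq, div_lt_div_iff₀ hb0 h1α]
    exact hnb
  have hinv : 1 / (1 - α) = q + 1 := by
    rw [hq]
    field_simp
    ring
  have hu_ne : ¬ u =ᵐ[volume] 0 := fun h => by
    simp [integral_congr_ae h] at hu_mass
  set M := ∫ x, ‖x‖ ^ b * u x with hM
  have : Nonempty (Fin n) := ⟨⟨0, hn⟩⟩
  have hM0 : 0 < M := by
    have hnonneg (x : EuclideanSpace ℝ (Fin n)) : 0 ≤ ‖x‖ ^ b * u x :=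
      mul_nonneg (by positivity) (hu_nonneg x)
    refine lt_of_le_of_ne (integral_nonneg hnonneg) fun h => hu_ne ?_
    filter_upwards [(integral_eq_zero_iff_of_nonneg hnonneg hu_mom).1 h.symm,
      Measure.ae_ne volume 0] with x hx hx0
    exact (mul_eq_zero.1 hx).resolve_left (rpow_pos_of_pos (norm_pos_iff.2 hx0) _).ne'
  set S := 2 * π ^ ((n : ℝ) / 2) / Gamma ((n : ℝ) / 2)
  have hS0 : 0 < S := by
    have := Gamma_pos_of_pos (half_pos hn0)
    positivity
  have hG₁ := Gamma_pos_of_pos (div_pos hn0 hb0)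
  have hG₂ := Gamma_pos_of_pos (sub_pos.2 hqn)
  have hG₃ := Gamma_pos_of_pos hq0
  set r := (α * b - n * (1 - α)) / (n * (1 - α)) with hr
  set s := α * b / (α * b - n * (1 - α)) with hs
  have hr0 : 0 < r := by positivity
  have hs0 : 0 < s := by positivity
  set c := (r * M)⁻¹ with hc
  have hc0 : 0 < c := by positivity
  set I := S / b * (Gamma ((n : ℝ) / b) * Gamma (q - (n : ℝ) / b) / Gamma q) * c ^ (-((n : ℝ) / b))
    with hI
  have hI0 : 0 < I := by positivity
  have hsum (x : EuclideanSpace ℝ (Fin n)) :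
      (1 + c * ‖x‖ ^ b) * u x = u x + c * (‖x‖ ^ b * u x) := by ring
  have hw_mass : ∫ x, (1 + c * ‖x‖ ^ b) * u x = s := by
    simp_rw [hsum]
    rw [integral_add hu_int (hu_mom.const_mul c), integral_const_mul, hu_mass, ← hM, hc, hr, hs]
    field_simp
    ring
  obtain ⟨hpos, hle⟩ := integral_rpow_pos_and_le_of_lintegral_le (w := fun x => 1 + c * ‖x‖ ^ b)
    ⟨hα0, hα1⟩ hu_meas hu_nonneg hu_ne (by fun_prop) (fun x => by positivity) hI0.le
    (by simp_rw [hsum]; exact hu_int.add (hu_mom.const_mul c)) hw_mass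
    (lintegral_one_add_mul_norm_rpow_rpow_neg n hn hb0 hc0 hqn)
  have hA' : A = S / b * (Gamma ((n : ℝ) / b) * Gamma (q - (n : ℝ) / b) / Gamma q) * s ^ q *
      r ^ ((n : ℝ) / b) := by
    have hqs : q - (n : ℝ) / b = q / s := by
      rw [hq, hs]
      field_simp
    rw [hA, hC₁, hinv, Gamma_add_one hq0.ne',
      show q + 1 - (n : ℝ) / b = q - (n : ℝ) / b + 1 by ring, Gamma_add_one (sub_pos.2 hqn).ne',
      rpow_add hs0, rpow_one]
    generalize Gamma (q - (n : ℝ) / b) = G at *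
    rw [hqs]
    field_simp
  have hA0 : 0 < A := by
    rw [hA']
    positivity
  have hI' : s ^ q * I = A * M ^ ((n : ℝ) / b) := by
    rw [hI, hA', hc, inv_rpow (by positivity), rpow_neg (by positivity), inv_inv,
      mul_rpow hr0.le hM0.le]
    ring
  have hlog := log_le_log hpos hle
  rw [log_mul (by positivity) (by positivity), log_rpow hs0, log_rpow hI0] at hlog
  have hlogI := congrArg log hI'
  rw [log_mul (by positivity) hI0.ne', log_mul hA0.ne' (by positivity),
    log_rpow hs0, log_rpow hM0] at hlogI
  calc
    _ ≤ (1 - α)⁻¹ * (α * log s + (1 - α) * log I) := by gcongr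
    _ = q * log s + log I := by
      rw [hq]
      field_simp
    _ = _ := by
      rw [hlogI, log_mul (by positivity) (by positivity), log_rpow hA0]
      field_simp
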